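/- arXiv:2010.14858 — 2 statements merged into one kernel-verified Lean document; each statement's English description precedes it below -/
import Mathlib

section
/- The function f(z) = z e^z E₁(z) is non-decreasing on (0, ∞); that is, for all 0 < z₁ ≤ z₂, z₁ e^{z₁} E₁(z₁) ≤ z₂ e^{z₂} E₁(z₂). -/
/-- The exponential integral function `E₁(z) = ∫₁^∞ e^{-zt}/t dt`. -/
noncomputable def E1 (z : ℝ) : ℝ := ∫ t in Set.Ioi (1 : ℝ), Real.exp (-z * t) / t

open MeasureTheory Set in
/-- The substitution `t = 1 + u / z` turns `z e^z E₁(z)` into a Laplace-type integral. -/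
lemma mul_exp_mul_E1_eq_integral {z : ℝ} (hz : 0 < z) :
    z * Real.exp z * E1 z = ∫ u in Ioi (0 : ℝ), Real.exp (-u) * (z / (u + z)) := by
  have translate : ∫ u in Ioi (0 : ℝ), Real.exp (-u) * (z / (u + z)) =
      ∫ s in Ioi (z * 1), Real.exp (z - s) * (z / s) := by
    have h := (measurePreserving_add_right volume z).setIntegral_preimage_emb
      (measurableEmbedding_addRight z) (fun s ↦ Real.exp (z - s) * (z / s)) (Ioi (z * 1))
    simpa using h
  rw [translate, ← integral_comp_mul_left_Ioi' _ _ hz, E1, smul_eq_mul, mul_assoc,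
    ← integral_const_mul]
  congr 1
  refine setIntegral_congr_fun measurableSet_Ioi fun t ht ↦ ?_
  have ht' : t ≠ 0 := (zero_lt_one.trans ht).ne'
  simp only [sub_eq_add_neg, Real.exp_add, neg_mul]
  field_simp

open MeasureTheory Set in
lemma integrableOn_exp_neg_mul_div_add {z : ℝ} (hz : 0 < z) :
    IntegrableOn (fun u ↦ Real.exp (-u) * (z / (u + z))) (Ioi (0 : ℝ)) := by
  refine (integrableOn_exp_neg_Ioi 0).mono' (by fun_prop) ?_
  filter_upwards [ae_restrict_mem measurableSet_Ioi] with u hu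
  have hu' : 0 < u := hu
  rw [Real.norm_of_nonneg (by positivity)]
  refine mul_le_of_le_one_right (Real.exp_pos _).le ?_
  rw [div_le_one (by positivity)]
  linarith

/-- The function `f(z) = z e^z E₁(z)` is non-decreasing on `(0, ∞)`. -/
theorem zexpE1_monotone (z₁ z₂ : ℝ) (h₁ : 0 < z₁) (h₂ : z₁ ≤ z₂) :
    z₁ * Real.exp z₁ * E1 z₁ ≤ z₂ * Real.exp z₂ * E1 z₂ := by
  have hz₂ : 0 < z₂ := h₁.trans_le h₂
  rw [mul_exp_mul_E1_eq_integral h₁, mul_exp_mul_E1_eq_integral hz₂]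
  refine MeasureTheory.setIntegral_mono_on (integrableOn_exp_neg_mul_div_add h₁)
    (integrableOn_exp_neg_mul_div_add hz₂) measurableSet_Ioi fun u hu ↦ ?_
  have hu' : 0 < u := hu
  refine mul_le_mul_of_nonneg_left ?_ (Real.exp_pos _).le
  rw [div_le_div_iff₀ (by positivity) (by positivity)]
  nlinarith
end

section
/- For every λ > 0, setting δ_λ = exp(−λ e^λ E₁(λ)), it holds that δ_λ ≤ (1 + 2/λ)^{−λ/2}. -/
open Real Set Filter Topology MeasureTheory

/-- For `y ≥ 1`, `log y ≤ (y - y⁻¹) / 2`. -/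
theorem log_le_half_sub_inv {y : ℝ} (hy : 1 ≤ y) : Real.log y ≤ (y - y⁻¹) / 2 := by
  rw [← Real.sinh_log (by linarith)]
  exact Real.self_le_sinh_iff.2 (Real.log_nonneg hy)

theorem log_one_add_two_div_le {u : ℝ} (hu : 0 < u) :
    Real.log (1 + 2 / u) + 2 / (u * (u + 2)) ≤ 2 / u := by
  have h := log_le_half_sub_inv (y := 1 + 2 / u) (by linarith [div_pos two_pos hu])
  have e : ((1 + 2 / u) - (1 + 2 / u)⁻¹) / 2 = 2 / u - 2 / (u * (u + 2)) := by
    have : u + 2 ≠ 0 := by positivity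
    have h1 : 1 + 2 / u = (u + 2) / u := by field_simp
    rw [h1, inv_div]
    field_simp
    ring
  linarith

theorem hasDerivAt_exp_mul_log_one_add {l t : ℝ} (hl : 0 < l) (ht : 0 < t) :
    HasDerivAt (fun s => -(1 / 2) * (Real.exp (-l * s) * Real.log (1 + 2 / (l * s))))
      (l / 2 * Real.exp (-l * t) *
        (Real.log (1 + 2 / (l * t)) + 2 / (l * t * (l * t + 2)))) t := by
  have hlt : 0 < l * t := mul_pos hl ht
  have h1 : HasDerivAt (fun s => Real.exp (-l * s)) (Real.exp (-l * t) * (-l * 1)) t :=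
    ((hasDerivAt_id t).const_mul (-l)).exp
  have h2 : HasDerivAt (fun s => 1 + 2 / (l * s))
      ((0 * (l * t) - 2 * (l * 1)) / (l * t) ^ 2) t :=
    ((hasDerivAt_const t (2 : ℝ)).div ((hasDerivAt_id t).const_mul l) hlt.ne').const_add 1
  have h3 := (h1.mul (h2.log (by positivity))).const_mul (-(1 / 2))
  refine h3.congr_deriv ?_
  have e : (0 * (l * t) - 2 * (l * 1)) / (l * t) ^ 2 / (1 + 2 / (l * t))
      = -l * (2 / (l * t * (l * t + 2))) := by
    have : l * t + 2 ≠ 0 := by positivity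
    have e1 : 1 + 2 / (l * t) = (l * t + 2) / (l * t) := by field_simp
    rw [e1]
    field_simp
    ring
  rw [e]
  ring

theorem tendsto_exp_mul_log_one_add {l : ℝ} (hl : 0 < l) :
    Tendsto (fun s => -(1 / 2) * (Real.exp (-l * s) * Real.log (1 + 2 / (l * s)))) atTop
      (𝓝 0) := by
  have hlin : Tendsto (fun s : ℝ => l * s) atTop atTop := tendsto_id.const_mul_atTop hl
  have h1 : Tendsto (fun s => Real.exp (-l * s)) atTop (𝓝 0) := by
    simpa [Function.comp_def] using Real.tendsto_exp_neg_atTop_nhds_zero.comp hlin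
  have h2 : Tendsto (fun s => 1 + 2 / (l * s)) atTop (𝓝 1) := by
    simpa using (hlin.const_div_atTop 2).const_add 1
  have h3 := (h1.mul (h2.log one_ne_zero)).const_mul (-(1 / 2))
  rwa [zero_mul, mul_zero] at h3

theorem integrableOn_exp_neg_mul_div {l : ℝ} (hl : 0 < l) :
    IntegrableOn (fun t => Real.exp (-l * t) / t) (Ioi 1) := by
  refine (integrableOn_exp_mul_Ioi (neg_lt_zero.2 hl) 1).mono'
    (by fun_prop : Measurable _).aestronglyMeasurable ?_
  refine (ae_restrict_iff' measurableSet_Ioi).2 (ae_of_all _ fun t ht => ?_)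
  have ht : 1 < t := ht
  rw [Real.norm_of_nonneg (by positivity)]
  exact div_le_self (by positivity) ht.le

theorem half_exp_neg_mul_log_le_E1 {l : ℝ} (hl : 0 < l) :
    1 / 2 * (Real.exp (-l) * Real.log (1 + 2 / l)) ≤ E1 l := by
  have hderiv : ∀ t ∈ Ici (1 : ℝ), _ := fun t ht =>
    hasDerivAt_exp_mul_log_one_add hl (one_pos.trans_le ht)
  have hnonneg : ∀ t ∈ Ioi (1 : ℝ), 0 ≤ l / 2 * Real.exp (-l * t) *
        (Real.log (1 + 2 / (l * t)) + 2 / (l * t * (l * t + 2))) := fun t ht => by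
    have ht0 : 0 < t := one_pos.trans ht
    have : 0 ≤ Real.log (1 + 2 / (l * t)) :=
      Real.log_nonneg (le_add_of_nonneg_right (by positivity))
    positivity
  have hintegral := integral_Ioi_of_hasDerivAt_of_nonneg' hderiv hnonneg
    (tendsto_exp_mul_log_one_add hl)
  have hle := setIntegral_mono_on
    (integrableOn_Ioi_deriv_of_nonneg' hderiv hnonneg (tendsto_exp_mul_log_one_add hl))
    (integrableOn_exp_neg_mul_div hl) measurableSet_Ioi fun t ht => by
      have ht0 : 0 < t := one_pos.trans ht
      calc _ ≤ l / 2 * Real.exp (-l * t) * (2 / (l * t)) := by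
            gcongr
            exact log_one_add_two_div_le (mul_pos hl ht0)
        _ = Real.exp (-l * t) / t := by field_simp
  rw [hintegral] at hle
  simpa [E1] using hle

/-- For every `λ > 0`, `δ_λ = exp(-λ e^λ E₁(λ)) ≤ (1 + 2/λ)^{-λ/2}`. -/
theorem deltaLam_le_rpow (lam : ℝ) (hlam : 0 < lam) :
    Real.exp (-(lam * Real.exp lam * E1 lam)) ≤ (1 + 2 / lam) ^ (-(lam / 2)) := by
  rw [Real.rpow_def_of_pos (by positivity), Real.exp_le_exp]
  have h := mul_le_mul_of_nonneg_left (half_exp_neg_mul_log_le_E1 hlam)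
    (by positivity : 0 ≤ lam * Real.exp lam)
  have e : lam * Real.exp lam * (1 / 2 * (Real.exp (-lam) * Real.log (1 + 2 / lam)))
      = lam / 2 * Real.log (1 + 2 / lam) := by
    rw [Real.exp_neg]
    field_simp
  linarith
end
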